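/- Let r ∈ [1, ∞) and let 𝟏_n ∈ 𝕀^n be the element consisting entirely of ones. Then ‖V_r(S_k χ_{𝟏_n} : k ∈ {0,1,...,n})‖_2 ≥ 2 n^{1/r} ‖χ_{𝟏_n}‖_2. -/

import Mathlib

open scoped ENNReal

/-- The spherical mean of radius `k` on the hypercube `{0,1}^n`. -/
noncomputable def sphMean (n k : ℕ) (f : (Fin n → Bool) → ℂ) (x : Fin n → Bool) : ℂ :=
  ((n.choose k : ℂ))⁻¹ * ∑ y ∈ Finset.univ.filter (fun y => hammingDist x y = k), f y

/-- The `r`-variation seminorm of `a` over the index set `Z`, valued in `[0,∞]`. -/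
noncomputable def eVar {ι : Type*} [LinearOrder ι] (r : ℝ) (a : ι → ℂ) (Z : Set ι) : ℝ≥0∞ :=
  ⨆ (J : ℕ) (t : Fin (J + 1) → ι) (_ : StrictMono t) (_ : ∀ j, t j ∈ Z),
    (∑ j : Fin J, (ENNReal.ofReal ‖a (t j.castSucc) - a (t j.succ)‖) ^ r) ^ r⁻¹

/-- The `ℓ²` norm of a `[0,∞]`-valued function on the hypercube. -/
noncomputable def eL2 {n : ℕ} (V : (Fin n → Bool) → ℝ≥0∞) : ℝ≥0∞ :=
  (∑ x : Fin n → Bool, V x ^ (2 : ℝ)) ^ ((2 : ℝ))⁻¹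

/-- The `ℓ²` norm of a complex function on the hypercube. -/
noncomputable def l2Norm {n : ℕ} (f : (Fin n → Bool) → ℂ) : ℝ :=
  Real.sqrt (∑ x : Fin n → Bool, ‖f x‖ ^ 2)

/-- The length (number of ones) of an element of the hypercube. -/
def wt {n : ℕ} (x : Fin n → Bool) : ℕ := (Finset.univ.filter (fun j => x j = true)).card

/-- The character `χ_y(x) = (-1)^{x·y}` on the hypercube. -/
noncomputable def chi {n : ℕ} (y x : Fin n → Bool) : ℂ :=
  (-1) ^ ((Finset.univ.filter (fun j => x j = true ∧ y j = true)).card)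

theorem chi_one_eq_prod {n : ℕ} (x : Fin n → Bool) :
    chi (fun _ => true) x = ∏ j, (if x j = true then (-1 : ℂ) else 1) := by
  simp [chi, Finset.prod_ite]

theorem chi_one_norm {n : ℕ} (x : Fin n → Bool) : ‖chi (fun _ => true) x‖ = 1 := by
  simp [chi]

theorem chi_one_of_dist {n : ℕ} (x y : Fin n → Bool) :
    chi (fun _ => true) y = (-1 : ℂ) ^ (hammingDist x y) * chi (fun _ => true) x := by
  have h : (-1 : ℂ) ^ (hammingDist x y) = ∏ j, (if x j ≠ y j then (-1 : ℂ) else 1) := by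
    simp [hammingDist, Finset.prod_ite]
  rw [h, chi_one_eq_prod, chi_one_eq_prod, ← Finset.prod_mul_distrib]
  refine Finset.prod_congr rfl fun j _ => ?_
  cases x j <;> cases y j <;> simp

theorem card_sphere {n : ℕ} (k : ℕ) (x : Fin n → Bool) :
    (Finset.univ.filter (fun y => hammingDist x y = k)).card = n.choose k := by
  have h : (Finset.powersetCard k (Finset.univ : Finset (Fin n))).card = n.choose k := by
    simp
  rw [← h]
  refine Finset.card_bij' (fun y _ => Finset.univ.filter (fun j => x j ≠ y j))
    (fun s _ => fun j => if j ∈ s then !(x j) else x j) ?_ ?_ ?_ ?_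
  · intro y hy
    simpa [Finset.mem_powersetCard, hammingDist] using hy
  · intro s hs
    simp only [Finset.mem_powersetCard] at hs
    simp only [Finset.mem_filter, Finset.mem_univ, true_and, hammingDist]
    rw [← hs.2]
    congr 1
    ext j
    by_cases hj : j ∈ s <;> simp [hj]
  · intro y _
    funext j
    cases hx : x j <;> cases hy : y j <;> simp [hx, hy]
  · intro s _
    ext j
    by_cases hj : j ∈ s <;> simp [hj]

theorem sphMean_chi {n k : ℕ} (hk : k ≤ n) (x : Fin n → Bool) :
    sphMean n k (chi (fun _ => true)) x = (-1 : ℂ) ^ k * chi (fun _ => true) x := by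
  unfold sphMean
  have h : ∀ y ∈ Finset.univ.filter (fun y => hammingDist x y = k),
      chi (fun _ => true) y = (-1 : ℂ) ^ k * chi (fun _ => true) x := by
    intro y hy
    rw [chi_one_of_dist x y, (Finset.mem_filter.mp hy).2]
  rw [Finset.sum_congr rfl h, Finset.sum_const, card_sphere, nsmul_eq_mul, ← mul_assoc,
    inv_mul_cancel₀, one_mul]
  exact_mod_cast (Nat.choose_pos hk).ne'

theorem eVar_ge (r : ℝ) (hr : 1 ≤ r) (n : ℕ) (x : Fin n → Bool) :
    ENNReal.ofReal (2 * (n : ℝ) ^ (1 / r)) ≤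
      eVar r (fun k => sphMean n k (chi (fun _ => true)) x) (Set.Iic n) := by
  unfold eVar
  refine le_trans ?_ (le_iSup_of_le n (le_iSup_of_le (fun j : Fin (n + 1) => (j : ℕ))
    (le_iSup_of_le (fun a b h => h) (le_iSup_of_le (fun j => Nat.lt_succ_iff.mp j.2) le_rfl))))
  have hr0 : 0 < r := by linarith
  have h : ∀ j : Fin n, ENNReal.ofReal
      ‖sphMean n ((j.castSucc : Fin (n + 1)) : ℕ) (chi (fun _ => true)) x
        - sphMean n ((j.succ : Fin (n + 1)) : ℕ) (chi (fun _ => true)) x‖ = 2 := by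
    intro j
    have h1 : (j : ℕ) ≤ n := j.2.le
    have h2 : (j : ℕ) + 1 ≤ n := j.2
    rw [Fin.val_castSucc, Fin.val_succ, sphMean_chi h1, sphMean_chi h2]
    have : (-1 : ℂ) ^ (j : ℕ) * chi (fun _ => true) x
        - (-1 : ℂ) ^ ((j : ℕ) + 1) * chi (fun _ => true) x
        = 2 * ((-1 : ℂ) ^ (j : ℕ) * chi (fun _ => true) x) := by ring
    rw [this, norm_mul, norm_mul, chi_one_norm]
    simp
  simp only [h]
  rw [Finset.sum_const, Finset.card_univ, Fintype.card_fin, nsmul_eq_mul,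
    ENNReal.mul_rpow_of_nonneg _ _ (by positivity), ENNReal.rpow_rpow_inv hr0.ne', one_div,
    ENNReal.ofReal_mul (by norm_num), ← ENNReal.ofReal_rpow_of_nonneg (by positivity) (by positivity)]
  simp [mul_comm]

/-- Counterexample: the `r`-variation of the spherical means of the character `χ_{1_n}`
has `ℓ²` norm at least `2 n^{1/r} ‖χ_{1_n}‖₂`. -/
theorem statement2 (r : ℝ) (hr : 1 ≤ r) (n : ℕ) (hn : 1 ≤ n) :
    ENNReal.ofReal (2 * (n : ℝ) ^ (1 / r) * l2Norm (chi (n := n) (fun _ => true))) ≤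
      eL2 (fun x => eVar r (fun k => sphMean n k (chi (fun _ => true)) x) (Set.Iic n)) := by
  have hl : l2Norm (chi (n := n) (fun _ => true)) = ((2 : ℝ) ^ n) ^ (2 : ℝ)⁻¹ := by
    unfold l2Norm
    simp only [chi_one_norm]
    rw [Real.sqrt_eq_rpow]
    simp
  have hc : (0 : ℝ) ≤ 2 * (n : ℝ) ^ (1 / r) := by positivity
  unfold eL2
  calc ENNReal.ofReal (2 * (n : ℝ) ^ (1 / r) * l2Norm (chi (n := n) (fun _ => true)))
      = (∑ _x : Fin n → Bool, ENNReal.ofReal (2 * (n : ℝ) ^ (1 / r)) ^ (2 : ℝ)) ^ ((2 : ℝ))⁻¹ := by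
        rw [hl, Finset.sum_const, nsmul_eq_mul, ENNReal.mul_rpow_of_nonneg _ _ (by positivity),
          ENNReal.rpow_rpow_inv (by norm_num), ENNReal.ofReal_mul hc,
          ← ENNReal.ofReal_rpow_of_nonneg (by positivity) (by positivity),
          ENNReal.ofReal_pow (by norm_num), mul_comm]
        simp
    _ ≤ _ := by
        gcongr with x
        exact eVar_ge r hr n x
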